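/- Let P be a positive random field on X^{ℤ^d}, F a filtration, V = {t_1, …, t_n} a finite subset of ℤ^d with a fixed enumeration, and x̄ ∈ 𝒳_V(F) a boundary condition such that g_V^{x̄}(w) > 0 for all w ∈ X^V. Fix u ∈ X^V. For z ∈ X^V and 1 ≤ j ≤ n let (zu)_j ∈ X^{V∖{t_j}} denote the configuration equal to z on {t_1,…,t_{j−1}} and to u on {t_{j+1},…,t_n}. Then for each j and z the boundary condition x̄(zu)_j belongs to 𝒳_{t_j}(F), the limits g_{t_j}^{x̄(zu)_j} are positive, and for every x ∈ X^V: g_V^{x̄}(x) = [∏_{j=1}^n g_{t_j}^{x̄(xu)_j}(x_{t_j})/g_{t_j}^{x̄(xu)_j}(u_{t_j})] · [Σ_{z ∈ X^V} ∏_{j=1}^n g_{t_j}^{x̄(zu)_j}(z_{t_j})/g_{t_j}^{x̄(zu)_j}(u_{t_j})]^{−1}. -/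

import Mathlib

open MeasureTheory Filter Topology

noncomputable section

/-- Sites of the lattice `ℤ^d`. -/
abbrev Site (d : ℕ) := Fin d → ℤ

/-- Configurations on the whole lattice. -/
abbrev Config (d : ℕ) (X : Type*) := Site d → X

variable {d : ℕ} {X : Type*}

/-- The configuration equal to `x` on `V` and to `z` off `V` (the concatenation `xz`). -/
def concat (V : Finset (Site d)) (x z : Config d X) : Config d X :=
  fun t => if t ∈ V then x t else z t

/-- The configuration equal to `u` on `I` and to `y` off `I`. -/
def extCfg (I : Finset (Site d)) (u : {s // s ∈ I} → X) (y : Config d X) : Config d X :=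
  fun t => if h : t ∈ I then u ⟨t, h⟩ else y t

/-- The cylinder set determined by the values of `z` on `Λ`. -/
def cyl (Λ : Finset (Site d)) (z : Config d X) : Set (Config d X) :=
  {ω | ∀ t ∈ Λ, ω t = z t}

/-- Finite-dimensional distribution `P_Λ(z)`. -/
def fdd [MeasurableSpace X] (P : Measure (Config d X)) (Λ : Finset (Site d))
    (z : Config d X) : ℝ :=
  (P (cyl Λ z)).toReal

/-- A positive random field: all finite-dimensional distributions are positive. -/
def IsPositiveRF [MeasurableSpace X] (P : Measure (Config d X)) : Prop :=
  ∀ Λ : Finset (Site d), Λ.Nonempty → ∀ z : Config d X, 0 < fdd P Λ z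

/-- Finite-conditional probability `g_V^z(x)` with boundary condition `z` on `Λ`. -/
def gfin [MeasurableSpace X] (P : Measure (Config d X)) (V Λ : Finset (Site d))
    (x z : Config d X) : ℝ :=
  fdd P (V ∪ Λ) (concat V x z) / fdd P Λ z

/-- A filtration: an increasing sequence of finite subsets of the lattice with union `ℤ^d`. -/
structure Filt (d : ℕ) where
  Λ : ℕ → Finset (Site d)
  mono : Monotone Λ
  covers : ∀ t : Site d, ∃ n, t ∈ Λ n

/-- The set `𝒳_V(F)` of admissible boundary conditions: those `x̄` for which all the limits
`lim_n g_V^{x̄_{Λ_n ∖ V}}(x)` exist. (Only the values of `x̄` off `V` are ever used.) -/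
def admissible [MeasurableSpace X] (P : Measure (Config d X)) (V : Finset (Site d))
    (F : Filt d) : Set (Config d X) :=
  {xb | ∀ x : Config d X, ∃ L : ℝ,
    Tendsto (fun n => gfin P V (F.Λ n \ V) x xb) atTop (𝓝 L)}

/-- The conditional probability `g_V^{x̄}(x)` : the limit of `g_V^{x̄_{Λ_n ∖ V}}(x)`. -/
def gCond [MeasurableSpace X] (P : Measure (Config d X)) (V : Finset (Site d))
    (F : Filt d) (xb x : Config d X) : ℝ :=
  limUnder atTop (fun n => gfin P V (F.Λ n \ V) x xb)

/-- Transition energy `Δ_V^{x̄}(x,u) = ln (g_V^{x̄}(x) / g_V^{x̄}(u))`. -/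
def TE [MeasurableSpace X] (P : Measure (Config d X)) (V : Finset (Site d))
    (F : Filt d) (xb x u : Config d X) : ℝ :=
  Real.log (gCond P V F xb x / gCond P V F xb u)

/-- Quasilocality (on boundary conditions off `V`) of a function `h` on a set `Y` of
boundary conditions. -/
def QuasilocalOn (V : Finset (Site d)) (Y : Set (Config d X)) (h : Config d X → ℝ) : Prop :=
  ∀ ε > 0, ∃ Λε : Finset (Site d), Disjoint Λε V ∧
    ∀ Λ : Finset (Site d), Disjoint Λ V → Λε ⊆ Λ →
      ∀ xb ∈ Y, ∀ yb ∈ Y, (∀ s ∈ Λ, xb s = yb s) → |h xb - h yb| < ε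

/-- `Y` represents a set of boundary conditions on `ℤ^d ∖ {t}`: membership does not depend
on the value at `t`. -/
def IsBCSet (t : Site d) (Y : Set (Config d X)) : Prop :=
  ∀ (ω : Config d X) (a : X), ω ∈ Y → Function.update ω t a ∈ Y

/-- `F` is a determining filtration for `P` with sets `Y t` of admissible boundary conditions:
the one-point finite-conditional probabilities converge, uniformly over `Y t`, to positive
limits, and `P(Y t) = 1`. -/
structure IsDetermining [MeasurableSpace X] (P : Measure (Config d X)) (F : Filt d)
    (Y : Site d → Set (Config d X)) : Prop where
  meas : ∀ t, MeasurableSet (Y t)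
  bc : ∀ t, IsBCSet t (Y t)
  adm : ∀ t, Y t ⊆ admissible P {t} F
  full : ∀ t, P (Y t) = 1
  pos : ∀ t, ∀ xb ∈ Y t, ∀ x : X, 0 < gCond P {t} F xb (fun _ => x)
  unif : ∀ (t : Site d) (x : X), ∀ ε > 0, ∃ N, ∀ n ≥ N, ∀ xb ∈ Y t,
    |gfin P {t} (F.Λ n \ {t}) (fun _ => x) xb - gCond P {t} F xb (fun _ => x)| < ε

/-- The probabilistic (Pr--) definition of a Gibbs random field. -/
def IsGibbsRF [MeasurableSpace X] (P : Measure (Config d X)) : Prop :=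
  IsProbabilityMeasure P ∧ IsPositiveRF P ∧
    ∃ (F : Filt d) (Y : Site d → Set (Config d X)), IsDetermining P F Y

/-- The boundary condition `x̄ (zu)_j` for the site `ts j`: equal to `z` at the sites `ts i`
with `i < j`, to `u` at the sites `ts i` with `i > j`, and to `xb` off `{ts i : i ≠ j}`. -/
def mixCfg {n : ℕ} (ts : Fin n → Site d) (j : Fin n) (z u xb : Config d X) : Config d X :=
  fun w =>
    if ∃ i, i < j ∧ ts i = w then z w
    else if ∃ i, j < i ∧ ts i = w then u w
    else xb w

/-- A configuration on `V = {ts 0, …, ts (n-1)}` given by its values `z : Fin n → X`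
at the enumerated sites (and `w0` elsewhere). -/
def ofIdx {n : ℕ} (ts : Fin n → Site d) (z : Fin n → X) (w0 : Config d X) : Config d X :=
  fun w => if h : ∃ i, ts i = w then z h.choose else w0 w

/-- A finite-dimensional distribution depends only on the values on `Λ`. -/
lemma fdd_congr [MeasurableSpace X] (P : Measure (Config d X)) {Λ Λ' : Finset (Site d)}
    {z z' : Config d X} (hΛ : Λ = Λ') (h : ∀ t ∈ Λ, z t = z' t) : fdd P Λ z = fdd P Λ' z' := by
  subst hΛ
  have : cyl Λ z = cyl Λ z' := by
    ext ω
    exact forall₂_congr fun t ht => by rw [h t ht]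
  rw [fdd, fdd, this]

/-- The finite-dimensional distributions of a positive random field are positive, also on `∅`. -/
lemma fdd_pos [MeasurableSpace X] {P : Measure (Config d X)} [IsProbabilityMeasure P]
    (hP : IsPositiveRF P) (Λ : Finset (Site d)) (z : Config d X) : 0 < fdd P Λ z := by
  rcases Λ.eq_empty_or_nonempty with rfl | hΛ
  · simp [fdd, cyl]
  · exact hP Λ hΛ z

/-- The conditional probability depends only on the values of the configuration on `V`. -/
lemma gCond_congr [MeasurableSpace X] (P : Measure (Config d X)) (V : Finset (Site d))
    (F : Filt d) (xb : Config d X) {x y : Config d X} (h : ∀ t ∈ V, x t = y t) :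
    gCond P V F xb x = gCond P V F xb y := by
  have : concat V x xb = concat V y xb := by
    funext t
    by_cases ht : t ∈ V <;> simp [concat, ht, h]
  simp only [gCond, gfin, this]

lemma tendsto_gfin [MeasurableSpace X] {P : Measure (Config d X)} {V : Finset (Site d)}
    {F : Filt d} {xb : Config d X} (hxb : xb ∈ admissible P V F) (x : Config d X) :
    Tendsto (fun m => gfin P V (F.Λ m \ V) x xb) atTop (𝓝 (gCond P V F xb x)) :=
  tendsto_nhds_limUnder (hxb x)

lemma measurableSet_cyl [MeasurableSpace X] [MeasurableSingletonClass X] (Λ : Finset (Site d))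
    (z : Config d X) : MeasurableSet (cyl Λ z) := by
  have : cyl Λ z = ⋂ t ∈ Λ, (fun ω : Config d X => ω t) ⁻¹' {z t} := by
    ext ω
    simp [cyl]
  rw [this]
  exact Finset.measurableSet_biInter _ fun t _ => measurable_pi_apply t (measurableSet_singleton _)

/-- Decomposition of a cylinder probability according to a finite-valued observable. -/
lemma fdd_eq_sum_of_fibers [MeasurableSpace X] [MeasurableSingletonClass X]
    (P : Measure (Config d X)) [IsProbabilityMeasure P] {ι : Type*} [Fintype ι]
    (f : Config d X → ι) (Λ Λ' : Finset (Site d)) (c : Config d X) (c' : ι → Config d X)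
    (h : ∀ i ω, ω ∈ cyl Λ' (c' i) ↔ ω ∈ cyl Λ c ∧ f ω = i) :
    fdd P Λ c = ∑ i, fdd P Λ' (c' i) := by
  have hU : cyl Λ c = ⋃ i, cyl Λ' (c' i) := by
    ext ω
    simp [h]
  have hd : Pairwise (Function.onFun Disjoint fun i => cyl Λ' (c' i)) := by
    intro i j hij
    refine Set.disjoint_left.2 fun ω hi hj => hij ?_
    rw [← ((h i ω).1 hi).2, ← ((h j ω).1 hj).2]
  simp only [fdd]
  rw [hU, measure_iUnion hd fun i => measurableSet_cyl _ _, tsum_fintype,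
    ENNReal.toReal_sum fun i _ => measure_ne_top _ _]

/-- Marginalization over one site. -/
lemma fdd_sdiff_singleton [Fintype X] [MeasurableSpace X] [MeasurableSingletonClass X]
    (P : Measure (Config d X)) [IsProbabilityMeasure P] {Λ : Finset (Site d)} {t : Site d}
    (ht : t ∈ Λ) (c : Config d X) :
    fdd P (Λ \ {t}) c = ∑ a, fdd P Λ (Function.update c t a) := by
  refine fdd_eq_sum_of_fibers P (fun ω => ω t) _ _ _ _ fun a ω => ⟨fun h => ⟨fun s hs => ?_, ?_⟩, ?_⟩
  · rw [Finset.mem_sdiff, Finset.mem_singleton] at hs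
    simpa [hs.2] using h s hs.1
  · simpa using h t ht
  · rintro ⟨h, ha⟩ s hs
    by_cases hst : s = t
    · subst hst
      simpa using ha
    · simpa [hst] using h s (by simp [hs, hst])

lemma ofIdx_apply {n : ℕ} {ts : Fin n → Site d} (hts : Function.Injective ts) (z : Fin n → X)
    (w0 : Config d X) (i : Fin n) : ofIdx ts z w0 (ts i) = z i := by
  have h : ∃ k, ts k = ts i := ⟨i, rfl⟩
  rw [ofIdx, dif_pos h, hts h.choose_spec]

/-- Marginalization over the sites of `V`. -/
lemma fdd_eq_sum_ofIdx [Fintype X] [MeasurableSpace X] [MeasurableSingletonClass X]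
    (P : Measure (Config d X)) [IsProbabilityMeasure P] {n : ℕ} {ts : Fin n → Site d}
    (hts : Function.Injective ts) {Λ : Finset (Site d)}
    (hΛ : Disjoint Λ (Finset.image ts Finset.univ)) (c u : Config d X) :
    fdd P Λ c = ∑ z : Fin n → X, fdd P (Finset.image ts Finset.univ ∪ Λ)
      (concat (Finset.image ts Finset.univ) (ofIdx ts z u) c) := by
  refine fdd_eq_sum_of_fibers P (fun ω i => ω (ts i)) _ _ _ _
    fun z ω => ⟨fun h => ⟨fun s hs => ?_, funext fun i => ?_⟩, ?_⟩
  · rw [h s (Finset.mem_union_right _ hs), concat, if_neg (Finset.disjoint_left.1 hΛ hs)]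
  · have hi : ts i ∈ Finset.image ts Finset.univ := Finset.mem_image_of_mem _ (Finset.mem_univ i)
    rw [h _ (Finset.mem_union_left _ hi), concat, if_pos hi, ofIdx_apply hts]
  · rintro ⟨h, rfl⟩ s hs
    by_cases hV : s ∈ Finset.image ts Finset.univ
    · obtain ⟨i, -, rfl⟩ := Finset.mem_image.1 hV
      rw [concat, if_pos hV, ofIdx_apply hts]
    · rw [concat, if_neg hV, h s ((Finset.mem_union.1 hs).resolve_left hV)]

lemma sum_gCond_ofIdx [Fintype X] [MeasurableSpace X] [MeasurableSingletonClass X]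
    {P : Measure (Config d X)} [IsProbabilityMeasure P] (hP : IsPositiveRF P) {F : Filt d}
    {n : ℕ} {ts : Fin n → Site d} (hts : Function.Injective ts) {xb : Config d X}
    (hxb : xb ∈ admissible P (Finset.image ts Finset.univ) F) (u : Config d X) :
    ∑ z : Fin n → X, gCond P (Finset.image ts Finset.univ) F xb (ofIdx ts z u) = 1 := by
  refine tendsto_nhds_unique
    (tendsto_finsetSum Finset.univ fun z _ => tendsto_gfin hxb (ofIdx ts z u)) ?_
  refine tendsto_const_nhds.congr fun m => ?_
  simp only [gfin]
  rw [← Finset.sum_div, ← fdd_eq_sum_ofIdx P hts Finset.sdiff_disjoint xb u,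
    div_self (fdd_pos hP _ _).ne']

lemma Filt.eventually_subset (F : Filt d) (V : Finset (Site d)) : ∀ᶠ m in atTop, V ⊆ F.Λ m := by
  have : ∀ t ∈ V, ∀ᶠ m in atTop, t ∈ F.Λ m := fun t _ => by
    obtain ⟨N, hN⟩ := F.covers t
    filter_upwards [eventually_ge_atTop N] with m hm using F.mono hm hN
  exact (V.eventually_all).2 this

/-- One-point conditional probabilities inside `V` are obtained from those on `V`. -/
lemma tendsto_gfin_singleton [Fintype X] [Nonempty X] [MeasurableSpace X]
    [MeasurableSingletonClass X]
    {P : Measure (Config d X)} [IsProbabilityMeasure P] (hP : IsPositiveRF P) {F : Filt d}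
    {V : Finset (Site d)} {xb : Config d X} (hxb : xb ∈ admissible P V F)
    (hpos : ∀ w : Config d X, 0 < gCond P V F xb w) {t : Site d} (ht : t ∈ V) {c : Config d X}
    (hc : ∀ s ∉ V, c s = xb s) (w : Config d X) :
    Tendsto (fun m => gfin P {t} (F.Λ m \ {t}) w c) atTop
      (𝓝 (gCond P V F xb (Function.update c t (w t)) /
        ∑ a, gCond P V F xb (Function.update c t a))) := by
  have hsum : 0 < ∑ a, gCond P V F xb (Function.update c t a) :=
    Finset.sum_pos (fun a _ => hpos _) Finset.univ_nonempty
  refine ((tendsto_gfin hxb _).div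
    (tendsto_finsetSum Finset.univ fun a _ => tendsto_gfin hxb (Function.update c t a))
    hsum.ne').congr' ?_
  filter_upwards [F.eventually_subset V] with m hm
  have hfdd : ∀ a, fdd P (V ∪ F.Λ m \ V) (concat V (Function.update c t a) xb) =
      fdd P (F.Λ m) (Function.update c t a) := fun a => by
    refine fdd_congr P (Finset.union_sdiff_of_subset hm) fun s _ => ?_
    by_cases hs : s ∈ V
    · simp [concat, hs]
    · have hst : s ≠ t := fun h => hs (h ▸ ht)
      simp [concat, hs, hst, hc]
  have hnum : fdd P ({t} ∪ F.Λ m \ {t}) (concat {t} w c) =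
      fdd P (F.Λ m) (Function.update c t (w t)) := by
    refine fdd_congr P (Finset.union_sdiff_of_subset (by simpa using hm ht)) fun s _ => ?_
    by_cases hst : s = t
    · subst hst
      simp [concat]
    · simp [concat, hst]
  simp only [Pi.div_apply, gfin, hfdd, hnum]
  rw [fdd_sdiff_singleton P (hm ht), ← Finset.sum_div,
    div_div_div_cancel_right₀ (fdd_pos hP _ _).ne']

lemma mixCfg_of_notMem {n : ℕ} (ts : Fin n → Site d) (j : Fin n) (z u xb : Config d X)
    {s : Site d} (hs : s ∉ Finset.image ts Finset.univ) : mixCfg ts j z u xb s = xb s := by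
  have : ∀ i, ts i ≠ s := by simpa using hs
  simp [mixCfg, this]

/-- The configuration equal to `x` at the first `k` sites and to `u` elsewhere. -/
def interpCfg {n : ℕ} (ts : Fin n → Site d) (x u : Config d X) (k : ℕ) : Config d X :=
  fun w => if ∃ i : Fin n, (i : ℕ) < k ∧ ts i = w then x w else u w

lemma interpCfg_apply {n : ℕ} {ts : Fin n → Site d} (hts : Function.Injective ts)
    (x u : Config d X) (k : ℕ) (i : Fin n) :
    interpCfg ts x u k (ts i) = if (i : ℕ) < k then x (ts i) else u (ts i) := by
  simp [interpCfg, hts.eq_iff]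

lemma mixCfg_apply {n : ℕ} {ts : Fin n → Site d} (hts : Function.Injective ts) (j : Fin n)
    (x u xb : Config d X) (i : Fin n) :
    mixCfg ts j x u xb (ts i) = if i < j then x (ts i) else if j < i then u (ts i)
      else xb (ts i) := by
  simp [mixCfg, hts.eq_iff]

lemma update_mixCfg_left {n : ℕ} {ts : Fin n → Site d} (hts : Function.Injective ts) (j : Fin n)
    (x u xb : Config d X) {s : Site d} (hs : s ∈ Finset.image ts Finset.univ) :
    Function.update (mixCfg ts j x u xb) (ts j) (x (ts j)) s = interpCfg ts x u (j + 1) s := by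
  obtain ⟨i, -, rfl⟩ := Finset.mem_image.1 hs
  rw [interpCfg_apply hts, Function.update_apply, mixCfg_apply hts]
  simp only [hts.eq_iff]
  grind

lemma update_mixCfg_right {n : ℕ} {ts : Fin n → Site d} (hts : Function.Injective ts) (j : Fin n)
    (x u xb : Config d X) {s : Site d} (hs : s ∈ Finset.image ts Finset.univ) :
    Function.update (mixCfg ts j x u xb) (ts j) (u (ts j)) s = interpCfg ts x u j s := by
  obtain ⟨i, -, rfl⟩ := Finset.mem_image.1 hs
  rw [interpCfg_apply hts, Function.update_apply, mixCfg_apply hts]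
  simp only [hts.eq_iff]
  grind

lemma prod_range_div_of_pos (f : ℕ → ℝ) (hf : ∀ k, 0 < f k) (n : ℕ) :
    ∏ k ∈ Finset.range n, f (k + 1) / f k = f n / f 0 := by
  induction n with
  | zero => simp [(hf 0).ne']
  | succ n ih => rw [Finset.prod_range_succ, ih, mul_comm, div_mul_div_cancel₀ (hf n).ne']

/-- The product of one-point ratios telescopes to a ratio of conditional probabilities on `V`. -/
lemma prod_gCond_div [Fintype X] [Nonempty X] [MeasurableSpace X] [MeasurableSingletonClass X]
    {P : Measure (Config d X)} [IsProbabilityMeasure P] (hP : IsPositiveRF P) {F : Filt d}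
    {n : ℕ} {ts : Fin n → Site d} (hts : Function.Injective ts) {xb : Config d X}
    (hxb : xb ∈ admissible P (Finset.image ts Finset.univ) F)
    (hpos : ∀ w : Config d X, 0 < gCond P (Finset.image ts Finset.univ) F xb w)
    (x u : Config d X) :
    ∏ j : Fin n, gCond P {ts j} F (mixCfg ts j x u xb) x /
        gCond P {ts j} F (mixCfg ts j x u xb) u =
      gCond P (Finset.image ts Finset.univ) F xb x /
        gCond P (Finset.image ts Finset.univ) F xb u := by
  set V := Finset.image ts Finset.univ
  have hfac : ∀ j : Fin n, gCond P {ts j} F (mixCfg ts j x u xb) x /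
      gCond P {ts j} F (mixCfg ts j x u xb) u =
      gCond P V F xb (interpCfg ts x u (j + 1)) / gCond P V F xb (interpCfg ts x u j) := by
    intro j
    have hlim : ∀ w, gCond P {ts j} F (mixCfg ts j x u xb) w = _ := fun w =>
      (tendsto_gfin_singleton hP hxb hpos (Finset.mem_image_of_mem ts (Finset.mem_univ j))
        (fun s hs => mixCfg_of_notMem ts j x u xb hs) w).limUnder_eq
    have hsum : 0 < ∑ a, gCond P V F xb (Function.update (mixCfg ts j x u xb) (ts j) a) :=
      Finset.sum_pos (fun a _ => hpos _) Finset.univ_nonempty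
    rw [hlim x, hlim u, div_div_div_cancel_right₀ hsum.ne',
      gCond_congr P V F xb fun s hs => update_mixCfg_left hts j x u xb hs,
      gCond_congr P V F xb fun s hs => update_mixCfg_right hts j x u xb hs]
  rw [Finset.prod_congr rfl fun j _ => hfac j,
    Fin.prod_univ_eq_prod_range (fun k => gCond P V F xb (interpCfg ts x u (k + 1)) /
      gCond P V F xb (interpCfg ts x u k)) n,
    prod_range_div_of_pos (fun k => gCond P V F xb (interpCfg ts x u k)) (fun k => hpos _)]
  congr 1 <;> refine gCond_congr P V F xb fun s hs => ?_ <;>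
    obtain ⟨i, -, rfl⟩ := Finset.mem_image.1 hs <;> simp [interpCfg_apply hts]

/-- Theorem 1 / `GP1->GP`: `G₁(P,F)` restores `G(P,F)`. -/
theorem stmt2 [Fintype X] [Nontrivial X] [MeasurableSpace X] [MeasurableSingletonClass X]
    (P : Measure (Config d X)) [IsProbabilityMeasure P] (hP : IsPositiveRF P)
    (F : Filt d) (n : ℕ) (hn : 0 < n) (ts : Fin n → Site d) (hts : Function.Injective ts)
    (xb : Config d X) (hxb : xb ∈ admissible P (Finset.image ts Finset.univ) F)
    (hpos : ∀ w : Config d X, 0 < gCond P (Finset.image ts Finset.univ) F xb w)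
    (u : Config d X) :
    (∀ (j : Fin n) (z : Fin n → X),
        mixCfg ts j (ofIdx ts z u) u xb ∈ admissible P {ts j} F ∧
        ∀ w : Config d X, 0 < gCond P {ts j} F (mixCfg ts j (ofIdx ts z u) u xb) w) ∧
    ∀ x : Config d X,
      gCond P (Finset.image ts Finset.univ) F xb x =
        (∏ j : Fin n,
            gCond P {ts j} F (mixCfg ts j x u xb) x /
              gCond P {ts j} F (mixCfg ts j x u xb) u) *
          (∑ z : Fin n → X, ∏ j : Fin n,
              gCond P {ts j} F (mixCfg ts j (ofIdx ts z u) u xb) (ofIdx ts z u) /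
                gCond P {ts j} F (mixCfg ts j (ofIdx ts z u) u xb) u)⁻¹ := by
  refine ⟨fun j z => ?_, fun x => ?_⟩
  · have hlim := tendsto_gfin_singleton hP hxb hpos
      (Finset.mem_image_of_mem ts (Finset.mem_univ j))
      (fun s hs => mixCfg_of_notMem ts j (ofIdx ts z u) u xb hs)
    refine ⟨fun w => ⟨_, hlim w⟩, fun w => ?_⟩
    rw [gCond, (hlim w).limUnder_eq]
    exact div_pos (hpos _) (Finset.sum_pos (fun a _ => hpos _) Finset.univ_nonempty)
  · simp only [prod_gCond_div hP hts hxb hpos]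
    rw [← Finset.sum_div, sum_gCond_ofIdx hP hts hxb, one_div, inv_inv,
      div_mul_cancel₀ _ (hpos u).ne']
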